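/- In the Bar-Natan algebra 𝓑, the subalgebra 1_•𝓑1_• of loops at the vertex • is isomorphic as a k-algebra to k[D, SS]/(D·SS), the commutative algebra generated by D_• and S_∘S_• with product zero. -/

import Mathlib

/- The Bar-Natan algebra 𝓑: path algebra over k of the quiver with two vertices
•, ∘ (idempotents eb, ec), loops Db, Dc, arrows Sb : • → ∘ and Sc : ∘ → •,
modulo D_∘S_• = S_•D_• = 0 and D_•S_∘ = S_∘D_∘ = 0.  Paths compose
right-to-left, so the product x * y is "path y followed by path x". -/

inductive BNGen : Type
  | eb | ec | Db | Dc | Sb | Sc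

variable (k : Type) [Field k]

noncomputable def bn (x : BNGen) : FreeAlgebra k BNGen := FreeAlgebra.ι k x

inductive BNRel : FreeAlgebra k BNGen → FreeAlgebra k BNGen → Prop
  | idem_b : BNRel (bn k .eb * bn k .eb) (bn k .eb)
  | idem_c : BNRel (bn k .ec * bn k .ec) (bn k .ec)
  | orth_bc : BNRel (bn k .eb * bn k .ec) 0
  | orth_cb : BNRel (bn k .ec * bn k .eb) 0
  | sum : BNRel (bn k .eb + bn k .ec) 1
  | Sb_src : BNRel (bn k .Sb * bn k .eb) (bn k .Sb)
  | Sb_tgt : BNRel (bn k .ec * bn k .Sb) (bn k .Sb)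
  | Sc_src : BNRel (bn k .Sc * bn k .ec) (bn k .Sc)
  | Sc_tgt : BNRel (bn k .eb * bn k .Sc) (bn k .Sc)
  | Db_src : BNRel (bn k .Db * bn k .eb) (bn k .Db)
  | Db_tgt : BNRel (bn k .eb * bn k .Db) (bn k .Db)
  | Dc_src : BNRel (bn k .Dc * bn k .ec) (bn k .Dc)
  | Dc_tgt : BNRel (bn k .ec * bn k .Dc) (bn k .Dc)
  | DcSb : BNRel (bn k .Dc * bn k .Sb) 0
  | SbDb : BNRel (bn k .Sb * bn k .Db) 0
  | DbSc : BNRel (bn k .Db * bn k .Sc) 0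
  | ScDc : BNRel (bn k .Sc * bn k .Dc) 0

/-- The quotient map onto the Bar-Natan algebra 𝓑 = RingQuot (BNRel k). -/
noncomputable def bnπ : FreeAlgebra k BNGen →ₐ[k] RingQuot (BNRel k) :=
  RingQuot.mkAlgHom k (BNRel k)


namespace BarNatan

open MvPolynomial

/-- The commutative algebra `k[D, SS] / (D · SS)`. -/
abbrev LoopAlg : Type :=
  MvPolynomial (Fin 2) k ⧸ Ideal.span {(X 0 * X 1 : MvPolynomial (Fin 2) k)}

/-- The image of a generator in the Bar-Natan algebra. -/
noncomputable def gen (x : BNGen) : RingQuot (BNRel k) := bnπ k (bn k x)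

variable {k}

lemma bnπ_eq_of_rel {x y : FreeAlgebra k BNGen} (h : BNRel k x y) : bnπ k x = bnπ k y :=
  RingQuot.mkAlgHom_rel k h

lemma eb_mul_eb : gen k .eb * gen k .eb = gen k .eb := by
  simpa [gen] using bnπ_eq_of_rel (BNRel.idem_b (k := k))

lemma eb_mul_ec : gen k .eb * gen k .ec = 0 := by
  simpa [gen] using bnπ_eq_of_rel (BNRel.orth_bc (k := k))

lemma ec_mul_eb : gen k .ec * gen k .eb = 0 := by
  simpa [gen] using bnπ_eq_of_rel (BNRel.orth_cb (k := k))

lemma Sb_mul_eb : gen k .Sb * gen k .eb = gen k .Sb := by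
  simpa [gen] using bnπ_eq_of_rel (BNRel.Sb_src (k := k))

lemma ec_mul_Sb : gen k .ec * gen k .Sb = gen k .Sb := by
  simpa [gen] using bnπ_eq_of_rel (BNRel.Sb_tgt (k := k))

lemma Sc_mul_ec : gen k .Sc * gen k .ec = gen k .Sc := by
  simpa [gen] using bnπ_eq_of_rel (BNRel.Sc_src (k := k))

lemma eb_mul_Sc : gen k .eb * gen k .Sc = gen k .Sc := by
  simpa [gen] using bnπ_eq_of_rel (BNRel.Sc_tgt (k := k))

lemma Db_mul_eb : gen k .Db * gen k .eb = gen k .Db := by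
  simpa [gen] using bnπ_eq_of_rel (BNRel.Db_src (k := k))

lemma eb_mul_Db : gen k .eb * gen k .Db = gen k .Db := by
  simpa [gen] using bnπ_eq_of_rel (BNRel.Db_tgt (k := k))

lemma Dc_mul_ec : gen k .Dc * gen k .ec = gen k .Dc := by
  simpa [gen] using bnπ_eq_of_rel (BNRel.Dc_src (k := k))

lemma Dc_mul_Sb : gen k .Dc * gen k .Sb = 0 := by
  simpa [gen] using bnπ_eq_of_rel (BNRel.DcSb (k := k))

lemma Sb_mul_Db : gen k .Sb * gen k .Db = 0 := by
  simpa [gen] using bnπ_eq_of_rel (BNRel.SbDb (k := k))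

lemma Db_mul_Sc : gen k .Db * gen k .Sc = 0 := by
  simpa [gen] using bnπ_eq_of_rel (BNRel.DbSc (k := k))

lemma eb_mul_Sb : gen k .eb * gen k .Sb = 0 := by
  rw [← ec_mul_Sb, ← mul_assoc, eb_mul_ec, zero_mul]

lemma Db_mul_Sb : gen k .Db * gen k .Sb = 0 := by
  rw [← Db_mul_eb, mul_assoc, eb_mul_Sb, mul_zero]

lemma Sb_mul_Sb : gen k .Sb * gen k .Sb = 0 := by
  calc
    _ = gen k .Sb * gen k .eb * gen k .Sb := by rw [Sb_mul_eb]
    _ = 0 := by rw [mul_assoc, eb_mul_Sb, mul_zero]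

lemma Dc_mul_eb : gen k .Dc * gen k .eb = 0 := by
  rw [← Dc_mul_ec, mul_assoc, ec_mul_eb, mul_zero]

lemma Sc_mul_eb : gen k .Sc * gen k .eb = 0 := by
  rw [← Sc_mul_ec, mul_assoc, ec_mul_eb, mul_zero]

variable (k)

open scoped IsMulCommutative in
/-- The unital algebra map `k[D, SS] / (D · SS) → 𝓑` hitting `D_•` and `S_∘S_•`. It exists because
these elements, together with `1_•`, generate a commutative subalgebra containing `1_•`. -/
lemma exists_algHom : ∃ ψ : LoopAlg k →ₐ[k] RingQuot (BNRel k),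
    ψ (Ideal.Quotient.mk _ (X 0)) = gen k .Db ∧
    ψ (Ideal.Quotient.mk _ (X 1)) = gen k .Sc * gen k .Sb ∧
    ∀ a, Commute (gen k .eb) (ψ a) := by
  have DS : gen k .Db * (gen k .Sc * gen k .Sb) = 0 := by
    rw [← mul_assoc, Db_mul_Sc, zero_mul]
  have SD : gen k .Sc * gen k .Sb * gen k .Db = 0 := by
    rw [mul_assoc, Sb_mul_Db, mul_zero]
  have eS : gen k .eb * (gen k .Sc * gen k .Sb) = gen k .Sc * gen k .Sb := by
    rw [← mul_assoc, eb_mul_Sc]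
  have Se : gen k .Sc * gen k .Sb * gen k .eb = gen k .Sc * gen k .Sb := by
    rw [mul_assoc, Sb_mul_eb]
  let s : Set (RingQuot (BNRel k)) := {gen k .eb, gen k .Db, gen k .Sc * gen k .Sb}
  have hs : ∀ a ∈ s, ∀ b ∈ s, a * b = b * a := by
    rintro a (rfl | rfl | rfl) b (rfl | rfl | rfl) <;>
      simp only [DS, SD, eS, Se, eb_mul_Db, Db_mul_eb]
  have := Algebra.isMulCommutative_adjoin k hs
  let v : Fin 2 → Algebra.adjoin k s :=
    ![⟨gen k .Db, Algebra.subset_adjoin (by simp [s])⟩,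
      ⟨gen k .Sc * gen k .Sb, Algebra.subset_adjoin (by simp [s])⟩]
  let e : Algebra.adjoin k s := ⟨gen k .eb, Algebra.subset_adjoin (by simp [s])⟩
  let ψ : MvPolynomial (Fin 2) k →ₐ[k] Algebra.adjoin k s := aeval v
  have hψ : ∀ a ∈ Ideal.span {(X 0 * X 1 : MvPolynomial (Fin 2) k)}, ψ a = 0 := by
    intro a ha
    obtain ⟨b, rfl⟩ := Ideal.mem_span_singleton.1 ha
    have h : v 0 * v 1 = 0 := Subtype.ext DS
    simp [ψ, h]
  refine ⟨(Algebra.adjoin k s).val.comp (Ideal.Quotient.liftₐ _ ψ hψ), ?_, ?_, ?_⟩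
  · change ((ψ (X 0) : Algebra.adjoin k s) : RingQuot (BNRel k)) = _
    simp [ψ, v]
  · change ((ψ (X 1) : Algebra.adjoin k s) : RingQuot (BNRel k)) = _
    simp [ψ, v]
  · intro a
    exact congrArg Subtype.val (mul_comm e (Ideal.Quotient.liftₐ _ ψ hψ a))

/-- The class of `SS` in `k[D, SS] / (D · SS)`. -/
noncomputable abbrev loopS : LoopAlg k := Ideal.Quotient.mk _ (X 1)

/-- The class of `D` in `k[D, SS] / (D · SS)`. -/
noncomputable abbrev loopD : LoopAlg k := Ideal.Quotient.mk _ (X 0)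

lemma loopD_mul_loopS : loopD k * loopS k = 0 := by
  rw [← map_mul, Ideal.Quotient.eq_zero_iff_mem]
  exact Ideal.subset_span rfl

/-- The ideal generated by `SS`. -/
noncomputable abbrev idealS : Ideal (LoopAlg k) := Ideal.span {loopS k}

/-- Multiplication by `SS`, as a map onto the ideal it generates. -/
noncomputable def mulS : LoopAlg k →ₗ[LoopAlg k] idealS k :=
  (LinearMap.mulLeft (LoopAlg k) (loopS k)).codRestrict (idealS k) fun a =>
    Ideal.mul_mem_right a _ (Ideal.subset_span rfl)

/-- The action of the generators of `𝓑` on `A × (SS)`, where `A = k[D, SS] / (D · SS)`: the arrow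
`S_•` is multiplication by `SS`, `S_∘` is the inclusion and `D_∘` is zero. -/
noncomputable def repGen : BNGen → Module.End (LoopAlg k) (LoopAlg k × idealS k)
  | .eb => LinearMap.inl _ _ _ ∘ₗ LinearMap.fst _ _ _
  | .ec => LinearMap.inr _ _ _ ∘ₗ LinearMap.snd _ _ _
  | .Db => LinearMap.inl _ _ _ ∘ₗ LinearMap.mulLeft _ (loopD k) ∘ₗ LinearMap.fst _ _ _
  | .Dc => 0
  | .Sb => LinearMap.inr _ _ _ ∘ₗ mulS k ∘ₗ LinearMap.fst _ _ _
  | .Sc => LinearMap.inl _ _ _ ∘ₗ (idealS k).subtype ∘ₗ LinearMap.snd _ _ _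

lemma loopD_mul_of_mem {a : LoopAlg k} (ha : a ∈ idealS k) : loopD k * a = 0 := by
  obtain ⟨b, rfl⟩ := Ideal.mem_span_singleton.1 ha
  rw [← mul_assoc, loopD_mul_loopS, zero_mul]

lemma mulS_loopD_mul (a : LoopAlg k) : mulS k (loopD k * a) = 0 := by
  refine Subtype.ext ?_
  change loopS k * (loopD k * a) = 0
  rw [← mul_assoc, mul_comm (loopS k), loopD_mul_loopS, zero_mul]

lemma repGen_rel {x y : FreeAlgebra k BNGen} (h : BNRel k x y) :
    FreeAlgebra.lift k (repGen k) x = FreeAlgebra.lift k (repGen k) y := by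
  cases h <;> refine LinearMap.ext fun ⟨a, b⟩ => ?_ <;>
    simp [bn, repGen, loopD_mul_of_mem, mulS_loopD_mul]

/-- The representation of `𝓑` on `A × (SS)`. -/
noncomputable def rep : RingQuot (BNRel k) →ₐ[k] Module.End (LoopAlg k) (LoopAlg k × idealS k) :=
  RingQuot.liftAlgHom k ⟨FreeAlgebra.lift k (repGen k), fun _ _ h => repGen_rel k h⟩

lemma rep_gen (x : BNGen) : rep k (gen k x) = repGen k x := by
  simp [rep, gen, bnπ, bn]

variable {k}

lemma rep_apply_inl {ψ : LoopAlg k →ₐ[k] RingQuot (BNRel k)}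
    (h0 : ψ (Ideal.Quotient.mk _ (X 0)) = gen k .Db)
    (h1 : ψ (Ideal.Quotient.mk _ (X 1)) = gen k .Sc * gen k .Sb) (a b : LoopAlg k) :
    rep k (ψ a) (b, 0) = (a * b, 0) := by
  obtain ⟨p, rfl⟩ := Ideal.Quotient.mk_surjective a
  induction p using MvPolynomial.induction_on generalizing b with
  | C r =>
    have h : (Ideal.Quotient.mk _ (C r) : LoopAlg k) = algebraMap k _ r := rfl
    rw [h, AlgHom.commutes, AlgHom.commutes, Module.algebraMap_end_apply, Prod.smul_mk, smul_zero,
      ← Algebra.smul_def]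
  | add p q hp hq => simp [hp, hq, add_mul]
  | mul_X p i hp =>
    rw [map_mul, map_mul, map_mul, Module.End.mul_apply, mul_assoc, ← hp]
    congr 1
    fin_cases i
    · simp [h0, rep_gen, repGen]
    · simp [h1, rep_gen, repGen]
      rfl

/-- The left ideal `𝓑 1_•` is spanned by the images of `ψ` and `S_• ψ`. -/
lemma exists_mul_eb_eq {ψ : LoopAlg k →ₐ[k] RingQuot (BNRel k)}
    (h0 : ψ (Ideal.Quotient.mk _ (X 0)) = gen k .Db)
    (h1 : ψ (Ideal.Quotient.mk _ (X 1)) = gen k .Sc * gen k .Sb)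
    (hc : ∀ a, Commute (gen k .eb) (ψ a)) (x : RingQuot (BNRel k)) :
    ∃ a b, x * gen k .eb = ψ a * gen k .eb + gen k .Sb * ψ b := by
  have eb_ψ (y) (a) : y * (ψ a * gen k .eb) = y * gen k .eb * ψ a := by
    rw [← (hc a).eq, mul_assoc]
  suffices h : ∀ y, (∃ a b, y = ψ a * gen k .eb + gen k .Sb * ψ b) →
      ∃ a b, x * y = ψ a * gen k .eb + gen k .Sb * ψ b from h _ ⟨1, 0, by simp⟩
  obtain ⟨x, rfl⟩ := RingQuot.mkAlgHom_surjective k (BNRel k) x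
  induction x using FreeAlgebra.induction with
  | grade0 r =>
    rintro y ⟨a, b, rfl⟩
    refine ⟨r • a, r • b, ?_⟩
    simp [← Algebra.smul_def]
  | grade1 g =>
    rintro y ⟨a, b, rfl⟩
    change ∃ a' b', gen k g * _ = _
    simp only [mul_add, eb_ψ, ← mul_assoc]
    cases g with
    | eb => exact ⟨a, 0, by simp [eb_mul_eb, eb_mul_Sb, (hc a).eq]⟩
    | ec => exact ⟨0, b, by simp [ec_mul_eb, ec_mul_Sb]⟩
    | Db =>
      refine ⟨Ideal.Quotient.mk _ (X 0) * a, 0, ?_⟩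
      rw [map_mul, mul_assoc (ψ _), ← (hc a).eq, h0, ← mul_assoc]
      simp [Db_mul_Sb]
    | Dc => exact ⟨0, 0, by simp [Dc_mul_eb, Dc_mul_Sb]⟩
    | Sb => exact ⟨0, a, by simp [Sb_mul_eb, Sb_mul_Sb]⟩
    | Sc =>
      refine ⟨Ideal.Quotient.mk _ (X 1) * b, 0, ?_⟩
      rw [map_mul, mul_assoc (ψ _), ← (hc b).eq, h1, ← mul_assoc,
        mul_assoc (gen k .Sc) _ (gen k .eb), Sb_mul_eb]
      simp [Sc_mul_eb]
  | mul x y hx hy =>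
    intro z hz
    rw [map_mul, mul_assoc]
    exact hx _ (hy _ hz)
  | add x y hx hy =>
    intro z hz
    obtain ⟨a, b, h⟩ := hx z hz
    obtain ⟨a', b', h'⟩ := hy z hz
    refine ⟨a + a', b + b', ?_⟩
    rw [map_add, add_mul, h, h', map_add, map_add, add_mul, mul_add]
    abel

end BarNatan

open MvPolynomial in
/- STATEMENT 4: the corner algebra 1_•𝓑1_• of loops at • is isomorphic as a
k-algebra to k[D,SS]/(D·SS):  there is a k-linear, multiplicative, unital
(onto 1_•) injection of k[X₀,X₁]/(X₀X₁) into 𝓑 sending X₀ ↦ D_•, X₁ ↦ S_∘S_•,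
whose image is exactly the set of loops at •, i.e. {x | 1_• x 1_• = x}. -/
theorem stmt4 :
    ∃ φ : (MvPolynomial (Fin 2) k ⧸
            Ideal.span {(X 0 * X 1 : MvPolynomial (Fin 2) k)}) →ₗ[k]
          RingQuot (BNRel k),
      (∀ a b, φ (a * b) = φ a * φ b) ∧
      φ 1 = bnπ k (bn k .eb) ∧
      φ (Ideal.Quotient.mk _ (X 0)) = bnπ k (bn k .Db) ∧
      φ (Ideal.Quotient.mk _ (X 1)) = bnπ k (bn k .Sc * bn k .Sb) ∧
      Function.Injective φ ∧
      Set.range φ =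
        {x : RingQuot (BNRel k) |
          bnπ k (bn k .eb) * x * bnπ k (bn k .eb) = x} := by
  obtain ⟨ψ, h0, h1, hc⟩ := BarNatan.exists_algHom k
  change ∃ φ : BarNatan.LoopAlg k →ₗ[k] RingQuot (BNRel k), _
  rw [map_mul]
  simp only [← BarNatan.gen.eq_1]
  have hφ (a) : (LinearMap.mulRight k (BarNatan.gen k .eb) ∘ₗ ψ.toLinearMap) a =
      ψ a * BarNatan.gen k .eb := rfl
  refine ⟨LinearMap.mulRight k (BarNatan.gen k .eb) ∘ₗ ψ.toLinearMap, ?_, ?_, ?_, ?_, ?_, ?_⟩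
  · intro a b
    rw [hφ, hφ, hφ, map_mul, mul_assoc (ψ a) (BarNatan.gen k .eb), ← mul_assoc _ (ψ b), (hc b).eq,
      mul_assoc (ψ b), BarNatan.eb_mul_eb, mul_assoc]
  · rw [hφ, map_one, one_mul]
  · rw [hφ, h0, BarNatan.Db_mul_eb]
  · rw [hφ, h1, mul_assoc, BarNatan.Sb_mul_eb]
  · intro a b hab
    have key (a) : BarNatan.rep k (ψ a * BarNatan.gen k .eb) (1, 0) = (a, 0) := by
      rw [map_mul, Module.End.mul_apply, BarNatan.rep_gen]
      simpa [BarNatan.repGen] using BarNatan.rep_apply_inl h0 h1 a 1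
    rw [hφ, hφ] at hab
    exact congrArg Prod.fst ((key a).symm.trans ((by rw [hab]) : _ = _) |>.trans (key b))
  · ext x
    constructor
    · rintro ⟨a, rfl⟩
      rw [Set.mem_ofPred_eq, hφ, ← mul_assoc, (hc a).eq, mul_assoc, mul_assoc, BarNatan.eb_mul_eb,
        BarNatan.eb_mul_eb]
    · intro hx
      obtain ⟨a, b, h⟩ := BarNatan.exists_mul_eb_eq h0 h1 hc x
      refine ⟨a, ?_⟩
      rw [hφ, ← Set.mem_ofPred_eq.mp hx, mul_assoc, h, mul_add, ← mul_assoc, (hc a).eq, mul_assoc,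
        BarNatan.eb_mul_eb, ← mul_assoc, BarNatan.eb_mul_Sb, zero_mul, add_zero]
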